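/- arXiv:2206.09314 — 4 statements merged into one kernel-verified Lean document; each statement's English description precedes it below -/
import Mathlib

section
/- Let X be a nonempty finite type and let p and q be probability mass functions on X with p(x) > 0 and q(x) > 0 for all x. Then the supremum over all functions D : X → (0,1) of ∑_{x∈X} [p(x)·log D(x) + q(x)·log(1−D(x))] equals ∑_{x∈X} [p(x)·log(p(x)/(p(x)+q(x))) + q(x)·log(q(x)/(p(x)+q(x)))], which equals 2·D_JS(p,q) − 2·log 2; moreover the supremum is attained at D(x) = p(x)/(p(x)+q(x)). -/
/-- Kullback–Leibler divergence of finite probability mass functions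
(with the convention `0 · log(0/c) = 0`, automatic since `0 * _ = 0`). -/
noncomputable def KLdiv {X : Type*} [Fintype X] (p q : X → ℝ) : ℝ :=
  ∑ x, p x * Real.log (p x / q x)

/-- Jensen–Shannon divergence of finite probability mass functions. -/
noncomputable def JSdiv {X : Type*} [Fintype X] (p q : X → ℝ) : ℝ :=
  (1 / 2) * KLdiv p (fun x => (p x + q x) / 2)
    + (1 / 2) * KLdiv q (fun x => (p x + q x) / 2)

theorem mul_log_le_mul_log_add_sub {a c d : ℝ} (ha : 0 < a) (hc : 0 < c) (hd : 0 < d) :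
    a * Real.log d ≤ a * Real.log (a / c) + (c * d - a) := by
  have hlog : Real.log d - Real.log (a / c) ≤ c * d / a - 1 := by
    have h := Real.log_le_sub_one_of_pos (x := d / (a / c)) (by positivity)
    rw [Real.log_div hd.ne' (by positivity)] at h
    convert h using 2
    field_simp
  have h := mul_le_mul_of_nonneg_left hlog ha.le
  have heq : a * (c * d / a - 1) = c * d - a := by field_simp
  linarith

theorem mul_log_add_mul_log_one_sub_le {a b d : ℝ} (ha : 0 < a) (hb : 0 < b)
    (hd : 0 < d) (hd1 : d < 1) :
    a * Real.log d + b * Real.log (1 - d) ≤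
      a * Real.log (a / (a + b)) + b * Real.log (b / (a + b)) := by
  have h1 := mul_log_le_mul_log_add_sub ha (add_pos ha hb) hd
  have h2 := mul_log_le_mul_log_add_sub hb (add_pos ha hb) (sub_pos.2 hd1)
  linarith

theorem one_sub_div_add {a b : ℝ} (ha : 0 < a) (hb : 0 < b) :
    1 - a / (a + b) = b / (a + b) := by
  field_simp
  ring

theorem log_div_half {a c : ℝ} (ha : 0 < a) (hc : 0 < c) :
    Real.log (a / (c / 2)) = Real.log (a / c) + Real.log 2 := by
  rw [← Real.log_mul (by positivity) (by norm_num)]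
  congr 1
  field_simp

theorem KLdiv_half {X : Type*} [Fintype X] {p m : X → ℝ} (hp : ∀ x, 0 < p x)
    (hm : ∀ x, 0 < m x) (hpsum : ∑ x, p x = 1) :
    KLdiv p (fun x => m x / 2) = KLdiv p m + Real.log 2 := by
  simp only [KLdiv, log_div_half (hp _) (hm _), mul_add, Finset.sum_add_distrib,
    ← Finset.sum_mul, hpsum, one_mul]

/-- Variational characterization of the Jensen–Shannon divergence: for strictly
positive pmfs `p`, `q` on a finite type, the supremum over discriminators
`D : X → (0,1)` of `∑ p·log D + q·log(1-D)` is attained and equals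
`∑ p·log(p/(p+q)) + q·log(q/(p+q)) = 2·D_JS(p,q) − 2·log 2`; the maximizer is
`D(x) = p(x)/(p(x)+q(x))`. -/
theorem js_variational_characterization {X : Type*} [Fintype X] [Nonempty X]
    (p q : X → ℝ) (hp : ∀ x, 0 < p x) (hq : ∀ x, 0 < q x)
    (hpsum : ∑ x, p x = 1) (hqsum : ∑ x, q x = 1) :
    IsGreatest {v : ℝ | ∃ D : X → ℝ, (∀ x, 0 < D x ∧ D x < 1) ∧
        v = ∑ x, (p x * Real.log (D x) + q x * Real.log (1 - D x))}
      (∑ x, (p x * Real.log (p x / (p x + q x)) + q x * Real.log (q x / (p x + q x)))) ∧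
    (∑ x, (p x * Real.log (p x / (p x + q x)) + q x * Real.log (q x / (p x + q x)))
      = 2 * JSdiv p q - 2 * Real.log 2) ∧
    (∑ x, (p x * Real.log (p x / (p x + q x)) + q x * Real.log (q x / (p x + q x)))
      = ∑ x, (p x * Real.log ((fun y => p y / (p y + q y)) x)
          + q x * Real.log (1 - (fun y => p y / (p y + q y)) x))) := by
  have hpq : ∀ x, 0 < p x + q x := fun x => add_pos (hp x) (hq x)
  have hopt : ∑ x, (p x * Real.log (p x / (p x + q x)) + q x * Real.log (q x / (p x + q x)))
      = ∑ x, (p x * Real.log (p x / (p x + q x)) + q x * Real.log (1 - p x / (p x + q x))) := by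
    simp only [one_sub_div_add (hp _) (hq _)]
  refine ⟨⟨⟨fun x => p x / (p x + q x), fun x => ⟨div_pos (hp x) (hpq x), ?_⟩, hopt⟩, ?_⟩,
    ?_, hopt⟩
  · exact (div_lt_one (hpq x)).2 (lt_add_of_pos_right _ (hq x))
  · rintro v ⟨D, hD, rfl⟩
    exact Finset.sum_le_sum fun x _ =>
      mul_log_add_mul_log_one_sub_le (hp x) (hq x) (hD x).1 (hD x).2
  · rw [JSdiv, KLdiv_half hp hpq hpsum, KLdiv_half hq hpq hqsum, Finset.sum_add_distrib]
    simp only [KLdiv]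
    ring
end

section
/- Let S and A be nonempty finite types, let γ ∈ (0,1), and let N ≥ 1 be a natural number. Let π and π_E^1, …, π_E^N be policies, each assigning to every s ∈ S a probability mass function on A. For each i ∈ {1,…,N} let μ^i : S → ℝ satisfy μ^i(s) ≥ 0 for all s and ∑_{s∈S} μ^i(s) = 1/(1−γ), and set ρ^i(s,a) := μ^i(s)·π(a|s); assume ρ^i(s,a) > 0 for all i, s, a. Let λ_1, …, λ_N : S → ℝ satisfy λ_j(s) > 0 for all j, s and ∑_{j=1}^N λ_j(s) = 1 for every s. Then (1/N)·∑_{i=1}^N ∑_{s∈S} μ^i(s)·∑_{j=1}^N λ_j(s)·D_JS(π(·|s), π_E^j(·|s)) = ∑_{i=1}^N ∑_{j=1}^N sup_{D : S×A → (0,1)} { ∑_{(s,a)∈S×A} (λ_j(s)/(2N))·[ ρ^i(s,a)·log(1−D(s,a)) + μ^i(s)·π_E^j(a|s)·log D(s,a) ] } + log 2/(1−γ), where the supremum ranges over all functions D from S×A into the open interval (0,1). -/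
open Filter Topology

/-- The optimal value over `d ∈ (0,1)` of `p * log (1 - d) + q * log d`. -/
noncomputable def binaryLogLoss (p q : ℝ) : ℝ :=
  p * Real.log (p / (p + q)) + q * Real.log (q / (p + q))

theorem mul_log_le_mul_log_div_add {p c x : ℝ} (hp : 0 ≤ p) (hc : 0 < c) (hx : 0 < x) :
    p * Real.log x ≤ p * Real.log (p / c) + (c * x - p) := by
  rcases hp.eq_or_lt with rfl | hp
  · simpa using (mul_pos hc hx).le
  · have hpc : 0 < p / c := div_pos hp hc
    have h := mul_le_mul_of_nonneg_left (Real.log_le_sub_one_of_pos (div_pos hx hpc)) hp.le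
    rw [Real.log_div hx.ne' hpc.ne'] at h
    have e : p * (x / (p / c) - 1) = c * x - p := by field_simp
    linarith

theorem mul_log_add_mul_log_le_binaryLogLoss {p q d : ℝ} (hp : 0 < p) (hq : 0 ≤ q)
    (h0 : 0 < d) (h1 : d < 1) :
    p * Real.log (1 - d) + q * Real.log d ≤ binaryLogLoss p q := by
  have hc : 0 < p + q := by positivity
  have h₁ := mul_log_le_mul_log_div_add hp.le hc (sub_pos.2 h1)
  have h₂ := mul_log_le_mul_log_div_add hq hc h0
  unfold binaryLogLoss
  linarith

theorem tendsto_mul_log_add_div_add {p c : ℝ} (hc : c ≠ 0) :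
    Tendsto (fun t : ℝ => p * Real.log ((p + t) / (c + 2 * t))) (𝓝[>] 0)
      (𝓝 (p * Real.log (p / c))) := by
  rcases eq_or_ne p 0 with rfl | hp
  · simp
  · have h : ContinuousAt (fun t : ℝ => p * Real.log ((p + t) / (c + 2 * t))) 0 := by
      have hne : (p + 0) / (c + 2 * 0) ≠ 0 := by simp [hp, hc]
      have hc' : c + 2 * 0 ≠ 0 := by simpa using hc
      fun_prop (disch := assumption)
    simpa [ContinuousAt] using h.tendsto.mono_left nhdsWithin_le_nhds

theorem isLUB_discriminator_objective {Y : Type*} [Fintype Y] {w p q : Y → ℝ}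
    (hw : ∀ y, 0 ≤ w y) (hp : ∀ y, 0 < p y) (hq : ∀ y, 0 ≤ q y) :
    IsLUB {v : ℝ | ∃ D : Y → ℝ, (∀ y, 0 < D y ∧ D y < 1) ∧
        v = ∑ y, w y * (p y * Real.log (1 - D y) + q y * Real.log (D y))}
      (∑ y, w y * binaryLogLoss (p y) (q y)) := by
  constructor
  · rintro v ⟨D, hD, rfl⟩
    exact Finset.sum_le_sum fun y _ => mul_le_mul_of_nonneg_left
      (mul_log_add_mul_log_le_binaryLogLoss (hp y) (hq y) (hD y).1 (hD y).2) (hw y)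
  · intro b hb
    have ht : Tendsto (fun t : ℝ => ∑ y, w y *
        (p y * Real.log ((p y + t) / (p y + q y + 2 * t))
          + q y * Real.log ((q y + t) / (p y + q y + 2 * t)))) (𝓝[>] 0)
        (𝓝 (∑ y, w y * binaryLogLoss (p y) (q y))) := by
      refine tendsto_finsetSum _ fun y _ => Tendsto.const_mul _ ?_
      have hc : p y + q y ≠ 0 := (add_pos_of_pos_of_nonneg (hp y) (hq y)).ne'
      exact (tendsto_mul_log_add_div_add hc).add (tendsto_mul_log_add_div_add hc)
    refine le_of_tendsto ht ?_
    filter_upwards [self_mem_nhdsWithin] with t (ht : 0 < t)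
    have hc : ∀ y, 0 < p y + q y + 2 * t := fun y => by
      have := hp y
      have := hq y
      positivity
    refine hb ⟨fun y => (q y + t) / (p y + q y + 2 * t), fun y => ⟨?_, ?_⟩, ?_⟩
    · exact div_pos (add_pos_of_nonneg_of_pos (hq y) ht) (hc y)
    · rw [div_lt_one (hc y)]
      linarith [hp y]
    · refine Finset.sum_congr rfl fun y _ => ?_
      have e : 1 - (q y + t) / (p y + q y + 2 * t) = (p y + t) / (p y + q y + 2 * t) := by
        rw [one_sub_div (hc y).ne']
        ring
      simp only [e]

theorem binaryLogLoss_mul {m : ℝ} (hm : m ≠ 0) (p q : ℝ) :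
    binaryLogLoss (m * p) (m * q) = m * binaryLogLoss p q := by
  unfold binaryLogLoss
  rw [← mul_add m p q, mul_div_mul_left _ _ hm, mul_div_mul_left _ _ hm]
  ring

theorem KLdiv_half_add {X : Type*} [Fintype X] {p c : X → ℝ} (hp1 : ∑ x, p x = 1)
    (hc : ∀ x, p x ≠ 0 → c x ≠ 0) :
    KLdiv p (fun x => c x / 2) = Real.log 2 + ∑ x, p x * Real.log (p x / c x) := by
  rw [KLdiv, ← one_mul (Real.log 2), ← hp1, Finset.sum_mul, ← Finset.sum_add_distrib]
  refine Finset.sum_congr rfl fun x _ => ?_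
  rcases eq_or_ne (p x) 0 with h | h
  · simp [h]
  · rw [← mul_add, ← Real.log_mul two_ne_zero (div_ne_zero h (hc x h)), div_div_eq_mul_div,
      mul_comm (p x) 2, mul_div_assoc]

theorem JSdiv_eq_log_two_add {X : Type*} [Fintype X] {p q : X → ℝ} (hp : ∀ x, 0 ≤ p x)
    (hq : ∀ x, 0 ≤ q x) (hp1 : ∑ x, p x = 1) (hq1 : ∑ x, q x = 1) :
    JSdiv p q = Real.log 2 + (1 / 2) * ∑ x, binaryLogLoss (p x) (q x) := by
  have h₁ : ∀ x, p x ≠ 0 → p x + q x ≠ 0 := fun x h =>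
    (add_pos_of_pos_of_nonneg ((hp x).lt_of_ne' h) (hq x)).ne'
  have h₂ : ∀ x, q x ≠ 0 → p x + q x ≠ 0 := fun x h =>
    (add_pos_of_nonneg_of_pos (hp x) ((hq x).lt_of_ne' h)).ne'
  simp only [JSdiv, binaryLogLoss]
  rw [KLdiv_half_add hp1 h₁, KLdiv_half_add hq1 h₂, Finset.sum_add_distrib]
  ring

/-- Theorem 5.1 (finite state-action setting): the objective
`(1/N) ∑_i ∑_s μ^i(s) ∑_j λ_j(s) D_JS(π(·|s), π_E^j(·|s))` equals the sum over `(i,j)`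
of the suprema over discriminators `D : S×A → (0,1)` of the weighted GAN-style
objectives, plus `log 2/(1-γ)`. -/
theorem rime_policy_objective_as_discriminator_sup
    {S A : Type*} [Fintype S] [Fintype A] [Nonempty S] [Nonempty A]
    (γ : ℝ) (hγ0 : 0 < γ) (hγ1 : γ < 1) (N : ℕ) (hN : 1 ≤ N)
    (π : S → A → ℝ) (hπ : ∀ s a, 0 ≤ π s a) (hπ1 : ∀ s, ∑ a, π s a = 1)
    (πE : Fin N → S → A → ℝ) (hπE : ∀ j s a, 0 ≤ πE j s a)
    (hπE1 : ∀ j s, ∑ a, πE j s a = 1)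
    (μ : Fin N → S → ℝ) (hμ : ∀ i s, 0 ≤ μ i s)
    (hμsum : ∀ i, ∑ s, μ i s = 1 / (1 - γ))
    (ρ : Fin N → S → A → ℝ) (hρdef : ∀ i s a, ρ i s a = μ i s * π s a)
    (hρpos : ∀ i s a, 0 < ρ i s a)
    (lam : Fin N → S → ℝ) (hlam : ∀ j s, 0 < lam j s)
    (hlamsum : ∀ s, ∑ j, lam j s = 1) :
    (1 / (N : ℝ)) * ∑ i, ∑ s, μ i s * ∑ j, lam j s * JSdiv (π s) (πE j s)
      = (∑ i, ∑ j,
          sSup {v : ℝ | ∃ D : S × A → ℝ, (∀ y, 0 < D y ∧ D y < 1) ∧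
            v = ∑ s, ∑ a, (lam j s / (2 * (N : ℝ))) *
                  (ρ i s a * Real.log (1 - D (s, a))
                    + μ i s * πE j s a * Real.log (D (s, a)))})
        + Real.log 2 / (1 - γ) := by
  have hN0 : (N : ℝ) ≠ 0 := Nat.cast_ne_zero.2 (Nat.one_le_iff_ne_zero.1 hN)
  have hμ0 : ∀ i s, μ i s ≠ 0 := fun i s h => by
    have := hρpos i s (Classical.arbitrary A)
    simp [hρdef, h] at this
  have hsup : ∀ i j,
      sSup {v : ℝ | ∃ D : S × A → ℝ, (∀ y, 0 < D y ∧ D y < 1) ∧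
        v = ∑ s, ∑ a, (lam j s / (2 * (N : ℝ))) *
              (ρ i s a * Real.log (1 - D (s, a))
                + μ i s * πE j s a * Real.log (D (s, a)))}
        = ∑ s, lam j s / (2 * N) * (μ i s * ∑ a, binaryLogLoss (π s a) (πE j s a)) := by
    intro i j
    have h := isLUB_discriminator_objective (Y := S × A)
      (w := fun y => lam j y.1 / (2 * (N : ℝ)))
      (p := fun y => ρ i y.1 y.2) (q := fun y => μ i y.1 * πE j y.1 y.2)
      (fun y => div_nonneg (hlam j y.1).le (by positivity)) (fun y => hρpos i y.1 y.2)
      (fun y => mul_nonneg (hμ i y.1) (hπE j y.1 y.2))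
    simp only [Fintype.sum_prod_type] at h
    rw [h.csSup_eq ⟨_, fun _ => 1 / 2, fun _ => by norm_num, rfl⟩]
    simp only [hρdef, binaryLogLoss_mul (hμ0 i _), Finset.mul_sum]
  have hmix : ∀ i s, μ i s * ∑ j, lam j s * JSdiv (π s) (πE j s)
      = μ i s * Real.log 2
        + N * ∑ j, lam j s / (2 * N) * (μ i s * ∑ a, binaryLogLoss (π s a) (πE j s a)) := by
    intro i s
    rw [← one_mul (Real.log 2), ← hlamsum s, Finset.sum_mul, Finset.mul_sum, Finset.mul_sum,
      Finset.mul_sum, ← Finset.sum_add_distrib]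
    refine Finset.sum_congr rfl fun j _ => ?_
    rw [JSdiv_eq_log_two_add (hπ s) (hπE j s) (hπ1 s) (hπE1 j s)]
    field_simp
  simp only [hsup, hmix]
  simp only [Finset.sum_add_distrib, ← Finset.sum_mul, ← Finset.mul_sum, hμsum]
  rw [Finset.sum_congr rfl fun i _ => Finset.sum_comm, Finset.sum_const, Finset.card_univ,
    Fintype.card_fin, nsmul_eq_mul]
  field_simp
  ring
end

section
/- Let X be a nonempty finite type, N ≥ 1 a natural number, and γ ∈ (0,1). Let ρ̄^1, …, ρ̄^N and ρ̄_E^1, …, ρ̄_E^N be probability mass functions on X with all values strictly positive, and set ρ^i := ρ̄^i/(1−γ) and ρ_E^j := ρ̄_E^j/(1−γ). Let λ_1, …, λ_N be nonnegative reals with ∑_{j=1}^N λ_j = 1. Then ∑_{j=1}^N λ_j·D_JS((1/N)·∑_{i=1}^N ρ̄^i, ρ̄_E^j) ≤ ∑_{i=1}^N ∑_{j=1}^N (λ_j·(1−γ)/(2N))·sup_{D : X → (0,1)} { ∑_{x∈X} [ρ^i(x)·log(1−D(x)) + ρ_E^j(x)·log D(x)] } + log 2, where the supremum ranges over all functions D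 from X into the open interval (0,1). -/
/-- The Jensen–Shannon divergence in terms of the optimal discriminator `q / (p + q)`. -/
theorem JSdiv_eq_optimal_discriminator {X : Type*} [Fintype X] {p q : X → ℝ}
    (hp : ∀ x, 0 < p x) (hq : ∀ x, 0 < q x) (hpsum : ∑ x, p x = 1) (hqsum : ∑ x, q x = 1) :
    JSdiv p q = (1 / 2) * ∑ x, (p x * Real.log (1 - q x / (p x + q x))
      + q x * Real.log (q x / (p x + q x))) + Real.log 2 := by
  have h : ∀ x, p x * Real.log (p x / ((p x + q x) / 2))
      + q x * Real.log (q x / ((p x + q x) / 2))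
      = (p x * Real.log (1 - q x / (p x + q x)) + q x * Real.log (q x / (p x + q x)))
        + (p x * Real.log 2 + q x * Real.log 2) := by
    intro x
    have hpx := hp x
    have hqx := hq x
    have hs : 0 < p x + q x := by positivity
    have e1 : 1 - q x / (p x + q x) = p x / (p x + q x) := by field_simp; ring
    rw [e1, div_div_eq_mul_div, div_div_eq_mul_div, mul_div_right_comm, mul_div_right_comm,
      Real.log_mul (by positivity) (by norm_num), Real.log_mul (by positivity) (by norm_num)]
    ring
  unfold JSdiv KLdiv
  rw [← mul_add, ← Finset.sum_add_distrib, Finset.sum_congr rfl fun x _ => h x,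
    Finset.sum_add_distrib, Finset.sum_add_distrib (f := fun x => p x * Real.log 2),
    ← Finset.sum_mul, ← Finset.sum_mul, hpsum, hqsum]
  ring

/-- The discriminator objective of any `D : X → (0, 1)` is at most the supremum. -/
theorem discriminator_le_sSup {X : Type*} [Fintype X] {p q : X → ℝ}
    (hp : ∀ x, 0 ≤ p x) (hq : ∀ x, 0 ≤ q x) {D : X → ℝ} (hD : ∀ x, 0 < D x ∧ D x < 1) :
    ∑ x, (p x * Real.log (1 - D x) + q x * Real.log (D x)) ≤
      sSup {v : ℝ | ∃ D : X → ℝ, (∀ x, 0 < D x ∧ D x < 1) ∧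
        v = ∑ x, (p x * Real.log (1 - D x) + q x * Real.log (D x))} := by
  refine le_csSup ⟨0, ?_⟩ ⟨D, hD, rfl⟩
  rintro v ⟨D, hD, rfl⟩
  refine Finset.sum_nonpos fun x _ => add_nonpos ?_ ?_
  · exact mul_nonpos_of_nonneg_of_nonpos (hp x)
      (Real.log_nonpos (by linarith [hD x]) (by linarith [hD x]))
  · exact mul_nonpos_of_nonneg_of_nonpos (hq x)
      (Real.log_nonpos (hD x).1.le (hD x).2.le)

/-- OMME upper bound (Section 5.4 / Appendix B.2):
`∑_j λ_j D_JS((1/N)∑_i ρ̄^i, ρ̄_E^j)` is bounded by the sum over `(i,j)` of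
`(λ_j(1−γ)/(2N))` times the discriminator suprema, plus `log 2`. -/
theorem omme_upper_bound {X : Type*} [Fintype X] [Nonempty X]
    (N : ℕ) (hN : 1 ≤ N) (γ : ℝ) (hγ0 : 0 < γ) (hγ1 : γ < 1)
    (ρbar ρbarE : Fin N → X → ℝ)
    (hρbar : ∀ i x, 0 < ρbar i x) (hρbarsum : ∀ i, ∑ x, ρbar i x = 1)
    (hρbarE : ∀ j x, 0 < ρbarE j x) (hρbarEsum : ∀ j, ∑ x, ρbarE j x = 1)
    (ρ ρE : Fin N → X → ℝ)
    (hρ : ∀ i x, ρ i x = ρbar i x / (1 - γ))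
    (hρE : ∀ j x, ρE j x = ρbarE j x / (1 - γ))
    (lam : Fin N → ℝ) (hlam : ∀ j, 0 ≤ lam j) (hlamsum : ∑ j, lam j = 1) :
    ∑ j, lam j * JSdiv (fun x => (1 / (N : ℝ)) * ∑ i, ρbar i x) (ρbarE j)
      ≤ (∑ i, ∑ j, (lam j * (1 - γ) / (2 * (N : ℝ))) *
          sSup {v : ℝ | ∃ D : X → ℝ, (∀ x, 0 < D x ∧ D x < 1) ∧
            v = ∑ x, (ρ i x * Real.log (1 - D x) + ρE j x * Real.log (D x))})
        + Real.log 2 := by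
  have hNpos : (0 : ℝ) < N := by exact_mod_cast hN
  have : NeZero N := ⟨by omega⟩
  have hγ : 0 < 1 - γ := by linarith
  set p : X → ℝ := fun x => (1 / (N : ℝ)) * ∑ i, ρbar i x with hpdef
  have hp : ∀ x, 0 < p x := fun x =>
    mul_pos (by positivity) (Finset.sum_pos (fun i _ => hρbar i x) Finset.univ_nonempty)
  have hpsum : ∑ x, p x = 1 := by
    rw [hpdef, ← Finset.mul_sum, Finset.sum_comm]
    simp [hρbarsum, hNpos.ne']
  have average : ∀ (j : Fin N) (D : X → ℝ),
      (1 / 2) * ∑ x, (p x * Real.log (1 - D x) + ρbarE j x * Real.log (D x))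
        = ∑ i, ((1 - γ) / (2 * (N : ℝ))) *
          ∑ x, (ρ i x * Real.log (1 - D x) + ρE j x * Real.log (D x)) := by
    intro j D
    rw [← Finset.mul_sum, Finset.sum_comm, Finset.mul_sum, Finset.mul_sum]
    refine Finset.sum_congr rfl fun x _ => ?_
    simp only [hρ, hρE, hpdef, Finset.sum_add_distrib, ← Finset.sum_mul, ← Finset.sum_div,
      Finset.sum_const, Finset.card_univ, Fintype.card_fin, nsmul_eq_mul]
    field_simp
  have bound : ∀ j, JSdiv p (ρbarE j) ≤ (∑ i, ((1 - γ) / (2 * (N : ℝ))) *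
      sSup {v : ℝ | ∃ D : X → ℝ, (∀ x, 0 < D x ∧ D x < 1) ∧
        v = ∑ x, (ρ i x * Real.log (1 - D x) + ρE j x * Real.log (D x))}) + Real.log 2 := by
    intro j
    rw [JSdiv_eq_optimal_discriminator hp (hρbarE j) hpsum (hρbarEsum j),
      average j fun x => ρbarE j x / (p x + ρbarE j x)]
    gcongr with i
    refine discriminator_le_sSup (fun x => ?_) (fun x => ?_) fun x => ?_
    · rw [hρ]; exact (div_pos (hρbar i x) hγ).le
    · rw [hρE]; exact (div_pos (hρbarE j x) hγ).le
    · have hs := add_pos (hp x) (hρbarE j x)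
      exact ⟨div_pos (hρbarE j x) hs, (div_lt_one hs).2 (by linarith [hp x])⟩
  refine (Finset.sum_le_sum fun j _ => mul_le_mul_of_nonneg_left (bound j) (hlam j)).trans_eq ?_
  simp only [mul_add, Finset.sum_add_distrib, ← Finset.sum_mul, hlamsum, one_mul, Finset.mul_sum]
  rw [Finset.sum_comm]
  simp only [← mul_assoc, mul_div_assoc]
end

section
/- In the finite MDP setting with discount factor γ ∈ (0,1), assume additionally that μ0(s) > 0 for every s ∈ S. Let ρ : S×A → ℝ satisfy ρ(s,a) ≥ 0 for all (s,a) and the state-marginal Bellman flow constraint ∑_{a∈A} ρ(s,a) = μ0(s) + γ·∑_{(s',a')∈S×A} P(s|s',a')·ρ(s',a') for every s ∈ S. Then ν(s) := ∑_{a∈A} ρ(s,a) > 0 for every s, and the policy π defined by π(a|s) := ρ(s,a)/ν(s) satisfies ρ_π = ρ. -/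
/-- The time-`t` state distribution of policy `π` in the finite MDP with initial
distribution `μ0` and transition kernel `P`. -/
noncomputable def stateDist {S A : Type*} [Fintype S] [Fintype A]
    (μ0 : S → ℝ) (π : S → A → ℝ) (P : S → A → S → ℝ) : ℕ → S → ℝ
  | 0 => μ0
  | t + 1 => fun s'' => ∑ s, ∑ a, stateDist μ0 π P t s * π s a * P s a s''

/-- The unnormalized (discounted) state distribution `μ_π(s) = ∑_t γ^t p_t(s)`. -/
noncomputable def muPi {S A : Type*} [Fintype S] [Fintype A]
    (γ : ℝ) (μ0 : S → ℝ) (π : S → A → ℝ) (P : S → A → S → ℝ) (s : S) : ℝ :=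
  ∑' t : ℕ, γ ^ t * stateDist μ0 π P t s

/-- The occupancy measure `ρ_π(s,a) = π(a|s) μ_π(s)`. -/
noncomputable def occ {S A : Type*} [Fintype S] [Fintype A]
    (γ : ℝ) (μ0 : S → ℝ) (π : S → A → ℝ) (P : S → A → S → ℝ) (s : S) (a : A) : ℝ :=
  π s a * muPi γ μ0 π P s

section StateDist

variable {S A : Type*} [Fintype S] [Fintype A]
  {μ ν : S → ℝ} {π : S → A → ℝ} {P : S → A → S → ℝ} {γ : ℝ}

lemma stateDist_nonneg (hμ : ∀ s, 0 ≤ μ s) (hπ : ∀ s a, 0 ≤ π s a)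
    (hP : ∀ s a s', 0 ≤ P s a s') (t : ℕ) (s : S) : 0 ≤ stateDist μ π P t s := by
  induction t generalizing s with
  | zero => exact hμ s
  | succ t ih =>
    exact Finset.sum_nonneg fun s' _ => Finset.sum_nonneg fun a _ =>
      mul_nonneg (mul_nonneg (ih s') (hπ s' a)) (hP s' a s)

lemma sum_stateDist (hπ : ∀ s, ∑ a, π s a = 1) (hP : ∀ s a, ∑ s', P s a s' = 1) (t : ℕ) :
    ∑ s, stateDist μ π P t s = ∑ s, μ s := by
  induction t with
  | zero => rfl
  | succ t ih =>
    simp only [stateDist]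
    rw [Finset.sum_comm, ← ih]
    refine Finset.sum_congr rfl fun s _ => ?_
    rw [Finset.sum_comm]
    simp only [← Finset.mul_sum, hP, mul_one, hπ]

lemma stateDist_eq_add_of_flow
    (h : ∀ s, ν s = μ s + γ * stateDist ν π P 1 s) (t : ℕ) (s : S) :
    stateDist ν π P t s = stateDist μ π P t s + γ * stateDist ν π P (t + 1) s := by
  induction t generalizing s with
  | zero => exact h s
  | succ t ih =>
    rw [stateDist, stateDist, stateDist]
    simp only [Finset.mul_sum, ← Finset.sum_add_distrib]
    refine Finset.sum_congr rfl fun s' _ => Finset.sum_congr rfl fun a _ => ?_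
    rw [ih s']
    ring

lemma eq_sum_range_add_of_flow
    (h : ∀ s, ν s = μ s + γ * stateDist ν π P 1 s) (n : ℕ) (s : S) :
    ν s = ∑ t ∈ Finset.range n, γ ^ t * stateDist μ π P t s
      + γ ^ n * stateDist ν π P n s := by
  induction n with
  | zero => simp [stateDist]
  | succ n ih =>
    rw [Finset.sum_range_succ]
    have := stateDist_eq_add_of_flow h n s
    rw [pow_succ]
    linear_combination ih + γ ^ n * this

/-- The discounted state distribution is the only nonnegative solution of the flow equation. -/
lemma hasSum_stateDist_of_flow (hγ0 : 0 ≤ γ) (hγ1 : γ < 1)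
    (hμ : ∀ s, 0 ≤ μ s) (hν : ∀ s, 0 ≤ ν s)
    (hπ : ∀ s a, 0 ≤ π s a) (hπsum : ∀ s, ∑ a, π s a = 1)
    (hP : ∀ s a s', 0 ≤ P s a s') (hPsum : ∀ s a, ∑ s', P s a s' = 1)
    (h : ∀ s, ν s = μ s + γ * stateDist ν π P 1 s) (s : S) :
    HasSum (fun t => γ ^ t * stateDist μ π P t s) (ν s) := by
  rw [hasSum_iff_tendsto_nat_of_nonneg
    fun t => mul_nonneg (pow_nonneg hγ0 t) (stateDist_nonneg hμ hπ hP t s)]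
  have hbound (n : ℕ) : stateDist ν π P n s ≤ ∑ s, ν s := by
    rw [← sum_stateDist (μ := ν) hπsum hPsum n]
    exact Finset.single_le_sum (fun s _ => stateDist_nonneg hν hπ hP n s) (Finset.mem_univ s)
  have hrem : Filter.Tendsto (fun n => γ ^ n * stateDist ν π P n s) Filter.atTop (nhds 0) := by
    refine squeeze_zero
      (fun n => mul_nonneg (pow_nonneg hγ0 n) (stateDist_nonneg hν hπ hP n s))
      (fun n => mul_le_mul_of_nonneg_left (hbound n) (pow_nonneg hγ0 n)) ?_
    simpa using (tendsto_pow_atTop_nhds_zero_of_lt_one hγ0 hγ1).mul_const (∑ s, ν s)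
  have hlim := hrem.const_sub (ν s)
  rw [sub_zero] at hlim
  exact hlim.congr fun n => by linarith [eq_sum_range_add_of_flow h n s]

end StateDist

/-- Proposition 3.1, second part: if `μ0 > 0` everywhere and `ρ ≥ 0` satisfies the
state-marginal Bellman flow constraint, then its state marginal `ν` is everywhere
positive and the policy `π(a|s) := ρ(s,a)/ν(s)` has occupancy measure exactly `ρ`. -/
theorem bellman_flow_solution_is_occ {S A : Type*} [Fintype S] [Fintype A]
    [Nonempty S] [Nonempty A]
    (γ : ℝ) (hγ0 : 0 < γ) (hγ1 : γ < 1)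
    (μ0 : S → ℝ) (hμ0pos : ∀ s, 0 < μ0 s) (hμ0sum : ∑ s, μ0 s = 1)
    (P : S → A → S → ℝ) (hP : ∀ s a s', 0 ≤ P s a s')
    (hPsum : ∀ s a, ∑ s', P s a s' = 1)
    (ρ : S → A → ℝ) (hρ : ∀ s a, 0 ≤ ρ s a)
    (hflow : ∀ s, ∑ a, ρ s a
      = μ0 s + γ * ∑ s', ∑ a', P s' a' s * ρ s' a') :
    (∀ s, 0 < ∑ a, ρ s a) ∧
    (∀ s a, occ γ μ0 (fun s a => ρ s a / ∑ a', ρ s a') P s a = ρ s a) := by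
  have hνpos : ∀ s, 0 < ∑ a, ρ s a := fun s => by
    rw [hflow s]
    exact add_pos_of_pos_of_nonneg (hμ0pos s) (mul_nonneg hγ0.le
      (Finset.sum_nonneg fun s' _ => Finset.sum_nonneg fun a _ =>
        mul_nonneg (hP s' a s) (hρ s' a)))
  refine ⟨hνpos, fun s a => ?_⟩
  have hsum := hasSum_stateDist_of_flow (ν := fun s => ∑ a, ρ s a)
    (π := fun s a => ρ s a / ∑ a', ρ s a') hγ0.le hγ1
    (fun s => (hμ0pos s).le) (fun s => (hνpos s).le)
    (fun s a => div_nonneg (hρ s a) (hνpos s).le)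
    (fun s => by rw [← Finset.sum_div, div_self (hνpos s).ne'])
    hP hPsum
    (fun s => by
      simp only [stateDist, mul_div_cancel₀ _ (hνpos _).ne']
      rw [hflow s]
      simp only [mul_comm (P _ _ _)]) s
  rw [occ, muPi, hsum.tsum_eq, div_mul_cancel₀ _ (hνpos s).ne']
end
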